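/- Let τ and τ′ be orderings of a finite set N with |N| = n such that InvWin(τ, τ′) ≤ r. Then there exists an index j ∈ [1, n] such that (i) the sets of elements on the first j positions coincide, i.e., N_τ(1, j) = N_{τ′}(1, j); (ii) Inv(τ(1, j), τ′(1, j)) ≤ r; and (iii) InvWin(τ(j+1, n), τ′(j+1, n)) ≤ r, where for i ≤ j the partial ordering τ(i, j) := (τ(i), τ(i+1), …, τ(j)) and N_τ(i, j) denotes the set of elements appearing on τ(i, j). -/

import Mathlib

/-- Swap the two consecutive elements at (0-based) positions `i` and `i+1`. -/
def swapAdj {α : Type*} : ℕ → List α → List α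
  | 0, a :: b :: l => b :: a :: l
  | n + 1, a :: l => a :: swapAdj n l
  | _, l => l

/-- Apply a sequence of inversions (given as a list of 0-based positions) to a list. -/
def applySeq {α : Type*} (S : List ℕ) (l : List α) : List α :=
  S.foldl (fun acc i => swapAdj i acc) l

/-- A sequence of inversions is valid for length `n` if every position lies in `[0, n-2]`. -/
def validSeq (n : ℕ) (S : List ℕ) : Prop := ∀ i ∈ S, i + 1 < n

/-- The inversions (Kendall tau) distance. -/
noncomputable def InvDist {α : Type*} (τ τ' : List α) : ℕ :=
  sInf {r | ∃ S : List ℕ, validSeq τ.length S ∧ S.length = r ∧ applySeq S τ = τ'}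

/-- `chainIntervals a n W` : `W` is a list of consecutive intervals `[a₁,b₁],…,[aℓ,bℓ]`
partitioning the positions `[a, n-1]`. -/
def chainIntervals : ℕ → ℕ → List (ℕ × ℕ) → Prop
  | a, n, [] => a = n
  | a, n, p :: W => p.1 = a ∧ p.1 ≤ p.2 ∧ p.2 < n ∧ chainIntervals (p.2 + 1) n W

/-- The width of a window partition `W` for a sequence of inversions `S`. -/
def winWidth (S : List ℕ) (W : List (ℕ × ℕ)) : ℕ :=
  W.foldr (fun p m => max (∑ j ∈ Finset.Icc p.1 p.2, S.count j) m) 0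

/-- The inversion-window distance `InvWin(τ, τ')`. -/
noncomputable def InvWinDist {α : Type*} (τ τ' : List α) : ℕ :=
  sInf {w | ∃ S : List ℕ, validSeq τ.length S ∧ applySeq S τ = τ' ∧
    ∃ W : List (ℕ × ℕ), chainIntervals 0 τ.length W ∧ (∀ p ∈ W, p.2 ∉ S) ∧
      winWidth S W = w}

theorem length_swapAdj {α : Type*} (i : ℕ) (l : List α) : (swapAdj i l).length = l.length := by
  fun_induction swapAdj i l <;> simp_all

theorem swapAdj_perm {α : Type*} (i : ℕ) (l : List α) : (swapAdj i l).Perm l := by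
  fun_induction swapAdj i l with
  | case1 a b l => exact List.Perm.swap a b l
  | case2 n a l ih => exact ih.cons a
  | case3 => exact List.Perm.refl _

theorem applySeq_perm {α : Type*} (S : List ℕ) (l : List α) : (applySeq S l).Perm l := by
  induction S generalizing l with
  | nil => exact List.Perm.refl _
  | cons i S ih => exact (ih (swapAdj i l)).trans (swapAdj_perm i l)

theorem swapAdj_append_left {α : Type*} (i : ℕ) (l₁ l₂ : List α) (h : i + 1 < l₁.length) :
    swapAdj i (l₁ ++ l₂) = swapAdj i l₁ ++ l₂ := by
  induction i generalizing l₁ with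
  | zero =>
    match l₁, h with
    | a :: b :: l, _ => rfl
  | succ n ih =>
    match l₁, h with
    | a :: l, h =>
      have h' : n + 1 < l.length := by simpa using h
      simp [swapAdj, ih l h']

theorem swapAdj_append_right {α : Type*} (k : ℕ) (l₁ l₂ : List α) :
    swapAdj (l₁.length + k) (l₁ ++ l₂) = l₁ ++ swapAdj k l₂ := by
  induction l₁ with
  | nil => simp
  | cons a l ih =>
    rw [List.length_cons, Nat.add_right_comm]
    simp [swapAdj, ih]

/-- A sequence that never inverts across the boundary of `l₁ ++ l₂` acts separately on the two
parts. -/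
theorem applySeq_append {α : Type*} (S : List ℕ) (j : ℕ) (l₁ l₂ : List α) (hj : l₁.length = j)
    (hS : ∀ i ∈ S, i + 1 ≠ j) :
    applySeq S (l₁ ++ l₂) =
      applySeq (S.filter (· < j)) l₁ ++ applySeq ((S.filter (j ≤ ·)).map (· - j)) l₂ := by
  induction S generalizing l₁ l₂ with
  | nil => rfl
  | cons i S ih =>
    have hi : i + 1 ≠ j := hS i (by simp)
    have hS' : ∀ i ∈ S, i + 1 ≠ j := fun k hk => hS k (by simp [hk])
    change applySeq S (swapAdj i (l₁ ++ l₂)) = _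
    rcases Nat.lt_or_ge i j with h | h
    · rw [swapAdj_append_left i l₁ l₂ (by omega),
        ih _ _ ((length_swapAdj i l₁).trans hj) hS']
      simp [h, applySeq]
    · obtain ⟨k, rfl⟩ := Nat.exists_eq_add_of_le h
      have hk := swapAdj_append_right k l₁ l₂
      rw [hj] at hk
      rw [hk, ih _ _ hj hS']
      simp [applySeq]

theorem applySeq_map_succ {α : Type*} (S : List ℕ) (a : α) (l : List α) :
    applySeq (S.map (· + 1)) (a :: l) = a :: applySeq S l := by
  induction S generalizing l with
  | nil => rfl
  | cons i S ih => exact ih (swapAdj i l)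

theorem exists_applySeq_of_perm {α : Type*} {τ τ' : List α} (h : τ.Perm τ') :
    ∃ S, validSeq τ.length S ∧ applySeq S τ = τ' := by
  induction h with
  | nil => exact ⟨[], by simp [validSeq], rfl⟩
  | cons a _ ih =>
    obtain ⟨S, hv, hS⟩ := ih
    refine ⟨S.map (· + 1), ?_, by rw [applySeq_map_succ, hS]⟩
    simpa [validSeq] using hv
  | swap a b l => exact ⟨[0], by simp [validSeq], rfl⟩
  | trans h _ ih₁ ih₂ =>
    obtain ⟨S, hv, hS⟩ := ih₁
    obtain ⟨T, hv', hT⟩ := ih₂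
    refine ⟨S ++ T, ?_, by simpa [applySeq, ← hS] using hT⟩
    intro i hi
    rcases List.mem_append.1 hi with hi | hi
    · exact hv i hi
    · rw [h.length_eq]
      exact hv' i hi

theorem exists_windows_of_invWinDist_le {α : Type*} {τ τ' : List α} {r : ℕ} (hp : τ.Perm τ')
    (hn : 0 < τ.length) (hw : InvWinDist τ τ' ≤ r) :
    ∃ S W, validSeq τ.length S ∧ applySeq S τ = τ' ∧ chainIntervals 0 τ.length W ∧
      (∀ p ∈ W, p.2 ∉ S) ∧ winWidth S W ≤ r := by
  obtain ⟨S, hv, hS⟩ := exists_applySeq_of_perm hp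
  have hne : {w | ∃ S : List ℕ, validSeq τ.length S ∧ applySeq S τ = τ' ∧
      ∃ W : List (ℕ × ℕ), chainIntervals 0 τ.length W ∧ (∀ p ∈ W, p.2 ∉ S) ∧
        winWidth S W = w}.Nonempty := by
    refine ⟨_, S, hv, hS, [(0, τ.length - 1)], ?_, ?_, rfl⟩
    · exact ⟨rfl, Nat.zero_le _, Nat.sub_one_lt_of_lt hn, Nat.sub_add_cancel hn⟩
    · simp only [List.mem_singleton, forall_eq]
      intro hmem
      have := hv _ hmem
      omega
  obtain ⟨T, hv, hT, W, hW, hmem, hwidth⟩ := Nat.sInf_mem hne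
  exact ⟨T, W, hv, hT, hW, hmem, hwidth.trans_le hw⟩

theorem winWidth_le_iff (S : List ℕ) (W : List (ℕ × ℕ)) (r : ℕ) :
    winWidth S W ≤ r ↔ ∀ p ∈ W, ∑ j ∈ Finset.Icc p.1 p.2, S.count j ≤ r := by
  induction W with
  | nil => simp [winWidth]
  | cons p W ih =>
    rw [List.forall_mem_cons, ← ih]
    simp [winWidth]

theorem sum_count_eq_countP (S : List ℕ) (s : Finset ℕ) :
    ∑ j ∈ s, S.count j = S.countP (· ∈ s) := by
  induction S with
  | nil => simp
  | cons i S ih => simp [List.count_cons, List.countP_cons, Finset.sum_add_distrib, ih]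

theorem le_fst_of_chainIntervals {a n : ℕ} {W : List (ℕ × ℕ)} (h : chainIntervals a n W) :
    ∀ p ∈ W, a ≤ p.1 ∧ p.1 ≤ p.2 := by
  induction W generalizing a with
  | nil => simp
  | cons q W ih =>
    obtain ⟨h₁, h₂, -, h₃⟩ := h
    rw [List.forall_mem_cons]
    refine ⟨⟨h₁.ge, h₂⟩, fun p hp => ?_⟩
    have := ih h₃ p hp
    omega

theorem chainIntervals_map_sub {j a n : ℕ} {W : List (ℕ × ℕ)} (hj : j ≤ a)
    (h : chainIntervals a n W) :
    chainIntervals (a - j) (n - j) (W.map fun p => (p.1 - j, p.2 - j)) := by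
  induction W generalizing a with
  | nil => exact congrArg (· - j) h
  | cons q W ih =>
    obtain ⟨h₁, h₂, h₃, h₄⟩ := h
    refine ⟨?_, ?_, ?_, ?_⟩
    · simp [h₁]
    · dsimp only
      omega
    · dsimp only
      omega
    · have := ih (by omega) h₄
      rwa [Nat.sub_add_comm (by omega)] at this

theorem sum_count_map_sub (S : List ℕ) {j a b : ℕ} (ha : j ≤ a) (hab : a ≤ b) :
    ∑ i ∈ Finset.Icc (a - j) (b - j), ((S.filter (j ≤ ·)).map (· - j)).count i =
      ∑ i ∈ Finset.Icc a b, S.count i := by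
  rw [sum_count_eq_countP, sum_count_eq_countP, List.countP_map, List.countP_filter]
  refine List.countP_congr fun i _ => ?_
  simp only [Function.comp, Finset.mem_Icc, Bool.and_eq_true, decide_eq_true_eq]
  omega

/-- If `InvWin(τ, τ') ≤ r` then there is an index `j ∈ [1, n]` such
that (i) the element sets of the first `j` positions coincide, (ii) the prefixes
have inversions distance at most `r`, and (iii) the suffixes have inversion-window
distance at most `r`. -/
theorem stmt14 {α : Type*} [DecidableEq α] (τ τ' : List α) (r : ℕ)
    (h1 : τ.Nodup) (h2 : τ'.Nodup) (hp : τ.Perm τ') (hn : 0 < τ.length)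
    (hw : InvWinDist τ τ' ≤ r) :
    ∃ j : ℕ, 1 ≤ j ∧ j ≤ τ.length ∧
      (τ.take j).toFinset = (τ'.take j).toFinset ∧
      InvDist (τ.take j) (τ'.take j) ≤ r ∧
      InvWinDist (τ.drop j) (τ'.drop j) ≤ r := by
  obtain ⟨S, W, hv, hS, hW, hmem, hwidth⟩ := exists_windows_of_invWinDist_le hp hn hw
  rw [winWidth_le_iff] at hwidth
  rcases W with _ | ⟨⟨a, b⟩, W⟩
  · exact absurd hW hn.ne
  obtain ⟨rfl, -, hb, hW⟩ := hW
  dsimp only at hb hW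
  rw [List.forall_mem_cons] at hmem hwidth
  have hbS : ∀ i ∈ S, i ≠ b := fun i hi h => hmem.1 (h ▸ hi)
  have hlen : (τ.take (b + 1)).length = b + 1 := by simpa using hb
  have hsplit := applySeq_append S (b + 1) (τ.take (b + 1)) (τ.drop (b + 1)) hlen
    fun i hi h => hbS i hi (Nat.succ_injective h)
  rw [List.take_append_drop, hS] at hsplit
  have hlen' : (applySeq (S.filter (· < b + 1)) (τ.take (b + 1))).length = b + 1 :=
    (applySeq_perm _ _).length_eq.trans hlen
  have htake : τ'.take (b + 1) = applySeq (S.filter (· < b + 1)) (τ.take (b + 1)) := by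
    rw [hsplit, List.take_left' hlen']
  have hdrop : τ'.drop (b + 1) =
      applySeq ((S.filter (b + 1 ≤ ·)).map (· - (b + 1))) (τ.drop (b + 1)) := by
    rw [hsplit, List.drop_left' hlen']
  refine ⟨b + 1, by omega, hb, ?_, ?_, ?_⟩
  · rw [htake]
    exact (List.toFinset_eq_of_perm _ _ (applySeq_perm _ _)).symm
  · refine le_trans (Nat.sInf_le ⟨S.filter (· < b + 1), ?_, rfl, htake.symm⟩) ?_
    · intro i hi
      rw [List.mem_filter, decide_eq_true_eq] at hi
      have := hbS i hi.1
      omega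
    · rw [← List.countP_eq_length_filter]
      refine le_trans (le_of_eq ?_) hwidth.1
      rw [sum_count_eq_countP]
      refine List.countP_congr fun i _ => ?_
      simp only [Finset.mem_Icc, decide_eq_true_eq]
      omega
  · refine le_trans (Nat.sInf_le ⟨(S.filter (b + 1 ≤ ·)).map (· - (b + 1)), ?_, hdrop.symm,
      W.map fun p => (p.1 - (b + 1), p.2 - (b + 1)), ?_, ?_, rfl⟩) ?_
    · intro i hi
      simp only [List.mem_map, List.mem_filter, decide_eq_true_eq] at hi
      obtain ⟨k, ⟨hk, hbk⟩, rfl⟩ := hi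
      have := hv k hk
      rw [List.length_drop]
      omega
    · have := chainIntervals_map_sub le_rfl hW
      rwa [Nat.sub_self, ← List.length_drop] at this
    · intro p hp hpS
      simp only [List.mem_map, List.mem_filter, decide_eq_true_eq] at hp hpS
      obtain ⟨q, hq, rfl⟩ := hp
      obtain ⟨k, ⟨hk, hbk⟩, hkq⟩ := hpS
      have hq' := le_fst_of_chainIntervals hW q hq
      have : k = q.2 := by
        dsimp only at hkq
        omega
      exact hmem.2 q hq (this ▸ hk)
    · rw [winWidth_le_iff, List.forall_mem_map]
      intro p hp
      have hp' := le_fst_of_chainIntervals hW p hp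
      exact (sum_count_map_sub S hp'.1 hp'.2).trans_le (hwidth.2 p hp)
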